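/- For each L > 0 there exists a constant c = c_L ≥ 1 such that for all r, t > 0 with r φ(1/t) ≤ L: (1/(c t)) r φ(1/t) ≤ p̄(r,t) ≤ (c/t) r φ(1/t). -/

import Mathlib

open MeasureTheory Filter Set
open scoped ENNReal Topology

/-- Finite measures on `ℝ` whose moment generating functions exist and agree on a half-line
`(-∞, a)` with `a > 0` are equal. -/
theorem Measure.ext_of_mgf_eqOn_Iio {P Q : Measure ℝ} [IsFiniteMeasure P] [IsFiniteMeasure Q]
    {a : ℝ} (ha : 0 < a)
    (hP : ∀ t < a, Integrable (fun x => Real.exp (t * x)) P)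
    (hQ : ∀ t < a, Integrable (fun x => Real.exp (t * x)) Q)
    (h : ∀ t < a, ∫ x, Real.exp (t * x) ∂P = ∫ x, Real.exp (t * x) ∂Q) : P = Q := by
  have hsub : ∀ {R : Measure ℝ}, (∀ t < a, Integrable (fun x => Real.exp (t * x)) R) →
      {z : ℂ | z.re < a} ⊆ {z | z.re ∈ interior (ProbabilityTheory.integrableExpSet id R)} :=
    fun {R} hR z hz => interior_maximal (s := ProbabilityTheory.integrableExpSet id R)
      (t := Iio a) (fun t ht => hR t ht) isOpen_Iio hz
  have key : EqOn (ProbabilityTheory.complexMGF id P) (ProbabilityTheory.complexMGF id Q)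
      {z : ℂ | z.re < a} := by
    refine AnalyticOnNhd.eqOn_of_preconnected_of_frequently_eq
      (ProbabilityTheory.analyticOnNhd_complexMGF.mono (hsub hP))
      (ProbabilityTheory.analyticOnNhd_complexMGF.mono (hsub hQ))
      (convex_halfSpace_re_lt a).isPreconnected (z₀ := 0) (by simpa using ha) ?_
    have h_real : ∃ᶠ x : ℝ in 𝓝[≠] 0,
        ProbabilityTheory.complexMGF id P x = ProbabilityTheory.complexMGF id Q x := by
      refine Eventually.frequently ?_
      filter_upwards [mem_nhdsWithin_of_mem_nhds (Iio_mem_nhds ha)] with x hx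
      rw [ProbabilityTheory.complexMGF_ofReal, ProbabilityTheory.complexMGF_ofReal]
      simpa [ProbabilityTheory.mgf] using h x hx
    rw [frequently_iff_seq_forall] at h_real ⊢
    obtain ⟨xs, hx_tendsto, hx_eq⟩ := h_real
    refine ⟨fun n ↦ xs n, ?_, fun n ↦ hx_eq n⟩
    rw [tendsto_nhdsWithin_iff] at hx_tendsto ⊢
    exact ⟨(Complex.continuous_ofReal.tendsto _).comp hx_tendsto.1, by simpa using hx_tendsto.2⟩
  refine Measure.ext_of_charFun (funext fun t => ?_)
  have := @key (t * Complex.I) (by simpa using ha)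
  rwa [ProbabilityTheory.complexMGF_id_mul_I, ProbabilityTheory.complexMGF_id_mul_I] at this

/-- Nonnegative functions whose Laplace transforms on `(0, ∞)` are finite and agree are equal
almost everywhere. -/
theorem ae_eq_of_laplace_eq {f g : ℝ → ℝ≥0∞} (hf : Measurable f) (hg : Measurable g)
    (hfin : ∀ l : ℝ, 0 < l → ∫⁻ x, ENNReal.ofReal (Real.exp (-l * x)) * f x ≠ ⊤)
    (h : ∀ l : ℝ, 0 < l → ∫⁻ x, ENNReal.ofReal (Real.exp (-l * x)) * f x =
      ∫⁻ x, ENNReal.ofReal (Real.exp (-l * x)) * g x) : f =ᵐ[volume] g := by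
  have hlin : ∀ {u : ℝ → ℝ≥0∞}, Measurable u → ∀ t : ℝ,
      ∫⁻ x, ENNReal.ofReal (Real.exp (t * x))
        ∂(volume.withDensity fun x => ENNReal.ofReal (Real.exp (-1 * x)) * u x) =
      ∫⁻ x, ENNReal.ofReal (Real.exp (-(1 - t) * x)) * u x := by
    intro u hu t
    rw [lintegral_withDensity_eq_lintegral_mul _ (by fun_prop) (by fun_prop)]
    refine lintegral_congr fun x => ?_
    rw [Pi.mul_apply, mul_right_comm, ← ENNReal.ofReal_mul (Real.exp_nonneg _), ← Real.exp_add]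
    ring_nf
  have hint : ∀ {u : ℝ → ℝ≥0∞}, Measurable u →
      (∀ l : ℝ, 0 < l → ∫⁻ x, ENNReal.ofReal (Real.exp (-l * x)) * u x ≠ ⊤) → ∀ t < (1 : ℝ),
      Integrable (fun x => Real.exp (t * x))
        (volume.withDensity fun x => ENNReal.ofReal (Real.exp (-1 * x)) * u x) := by
    intro u hu hfu t ht
    refine (lintegral_ofReal_ne_top_iff_integrable (by fun_prop)
      (ae_of_all _ fun x => (Real.exp_nonneg _))).1 ?_
    rw [hlin hu]
    exact hfu _ (by linarith)
  have hfing : ∀ l : ℝ, 0 < l → ∫⁻ x, ENNReal.ofReal (Real.exp (-l * x)) * g x ≠ ⊤ :=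
    fun l hl => h l hl ▸ hfin l hl
  have := isFiniteMeasure_withDensity (hfin 1 one_pos)
  have := isFiniteMeasure_withDensity (hfing 1 one_pos)
  have key := Measure.ext_of_mgf_eqOn_Iio one_pos (hint hf hfin) (hint hg hfing) (fun t ht => by
    rw [integral_eq_lintegral_of_nonneg_ae (ae_of_all _ fun x => Real.exp_nonneg _) (by fun_prop),
      integral_eq_lintegral_of_nonneg_ae (ae_of_all _ fun x => Real.exp_nonneg _) (by fun_prop),
      hlin hf, hlin hg, h _ (by linarith)])
  rw [withDensity_eq_iff (by fun_prop) (by fun_prop) (hfin 1 one_pos)] at key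
  filter_upwards [key] with x hx
  exact (ENNReal.mul_right_inj (by simpa using Real.exp_pos _) ENNReal.ofReal_ne_top).1 hx

/-- The Laplace transform of an additive convolution is the product of Laplace transforms. -/
theorem lintegral_exp_mul_lconvolution {f g : ℝ → ℝ≥0∞} (hf : Measurable f) (hg : Measurable g)
    (l : ℝ) :
    ∫⁻ x, ENNReal.ofReal (Real.exp (l * x)) * ∫⁻ y, f y * g (-y + x) =
      (∫⁻ x, ENNReal.ofReal (Real.exp (l * x)) * f x) *
        ∫⁻ x, ENNReal.ofReal (Real.exp (l * x)) * g x := by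
  calc
    _ = ∫⁻ x, ∫⁻ y, (ENNReal.ofReal (Real.exp (l * y)) * f y) *
          (ENNReal.ofReal (Real.exp (l * (-y + x))) * g (-y + x)) := by
      refine lintegral_congr fun x => ?_
      rw [← lintegral_const_mul _ (by fun_prop)]
      refine lintegral_congr fun y => ?_
      rw [mul_mul_mul_comm, ← ENNReal.ofReal_mul (Real.exp_nonneg _), ← Real.exp_add]
      ring_nf
    _ = ∫⁻ y, ∫⁻ x, (ENNReal.ofReal (Real.exp (l * y)) * f y) *
          (ENNReal.ofReal (Real.exp (l * (-y + x))) * g (-y + x)) :=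
      lintegral_lintegral_swap (by fun_prop)
    _ = _ := by
      rw [← lintegral_mul_const _ (by fun_prop)]
      refine lintegral_congr fun y => ?_
      rw [lintegral_const_mul _ (by fun_prop)]
      congr 1
      exact lintegral_add_left_eq_self
        (fun x => ENNReal.ofReal (Real.exp (l * x)) * g x) (-y)

section LaplaceExponent

variable {ν : Measure ℝ}

theorem integrableOn_min_one (hν : ∫⁻ x in Ioi (0 : ℝ), ENNReal.ofReal (min 1 x) ∂ν ≠ ⊤) :
    IntegrableOn (fun x => min 1 x) (Ioi 0) ν := by
  refine (lintegral_ofReal_ne_top_iff_integrable (by fun_prop) ?_).1 hν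
  filter_upwards [ae_restrict_mem measurableSet_Ioi] with x hx
  exact le_min zero_le_one (le_of_lt hx)

theorem integrableOn_one_sub_exp (hν : ∫⁻ x in Ioi (0 : ℝ), ENNReal.ofReal (min 1 x) ∂ν ≠ ⊤)
    {l : ℝ} (hl : 0 < l) : IntegrableOn (fun x => 1 - Real.exp (-l * x)) (Ioi 0) ν := by
  refine Integrable.mono' ((integrableOn_min_one hν).const_mul (1 + l)) (by fun_prop) ?_
  filter_upwards [ae_restrict_mem measurableSet_Ioi] with x (hx : 0 < x)
  have h1 := Real.add_one_le_exp (-l * x)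
  have h2 := Real.exp_pos (-l * x)
  have h3 : Real.exp (-l * x) ≤ 1 := Real.exp_le_one_iff.2 (by nlinarith)
  rw [Real.norm_of_nonneg (by linarith)]
  rcases le_total 1 x with h | h
  · rw [min_eq_left h]; linarith
  · rw [min_eq_right h]; nlinarith

/-- A Laplace exponent may be differentiated under the integral sign. -/
theorem hasDerivAt_laplaceExponent
    (hν : ∫⁻ x in Ioi (0 : ℝ), ENNReal.ofReal (min 1 x) ∂ν ≠ ⊤) {l : ℝ} (hl : 0 < l) :
    IntegrableOn (fun x => x * Real.exp (-l * x)) (Ioi 0) ν ∧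
    HasDerivAt (fun l => ∫ x in Ioi (0 : ℝ), (1 - Real.exp (-l * x)) ∂ν)
      (∫ x in Ioi (0 : ℝ), x * Real.exp (-l * x) ∂ν) l := by
  refine hasDerivAt_integral_of_dominated_loc_of_deriv_le
    (F := fun l x => 1 - Real.exp (-l * x)) (F' := fun l x => x * Real.exp (-l * x))
    (s := Ioi (l / 2)) (bound := fun x => (1 + 2 / l) * min 1 x)
    (Ioi_mem_nhds (by linarith)) (Eventually.of_forall fun _ => by fun_prop)
    (integrableOn_one_sub_exp hν hl) (by fun_prop) ?_
    ((integrableOn_min_one hν).const_mul _) ?_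
  · filter_upwards [ae_restrict_mem measurableSet_Ioi] with x (hx : 0 < x) m (hm : l / 2 < m)
    have h2 := Real.exp_pos (-m * x)
    have h3 : Real.exp (-m * x) ≤ 1 := Real.exp_le_one_iff.2 (by nlinarith)
    rw [Real.norm_of_nonneg (by positivity)]
    have hl' : 0 < 2 / l := by positivity
    rcases le_total 1 x with h | h
    · rw [min_eq_left h]
      have h4 : Real.exp (-m * x) ≤ Real.exp (-(l / 2 * x)) := Real.exp_le_exp.2 (by nlinarith)
      have h5 := Real.add_one_le_exp (l / 2 * x)
      have h6 : Real.exp (-(l / 2 * x)) * Real.exp (l / 2 * x) = 1 := by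
        rw [← Real.exp_add]; simp
      have h7 : x * Real.exp (-(l / 2 * x)) ≤ 2 / l := by
        rw [le_div_iff₀ hl]
        nlinarith [Real.exp_pos (-(l / 2 * x))]
      nlinarith
    · rw [min_eq_right h]; nlinarith
  · filter_upwards with x m _
    have : HasDerivAt (fun l : ℝ => -l * x) (-1 * x) m := (hasDerivAt_id m).neg.mul_const x
    convert! (this.exp.const_sub 1) using 1
    ring

end LaplaceExponent

/-- The Laplace exponent `φ` of a probability measure `P` on `ℝ` determines the Laplace transform
of the measure `s P(ds)`. -/
theorem lintegral_exp_mul_ofReal_of_laplace {P : Measure ℝ} [IsProbabilityMeasure P]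
    (hP : ∀ᵐ s ∂P, 0 ≤ s) {φ : ℝ → ℝ} {r : ℝ}
    (hlap : ∀ l : ℝ, 0 < l → ∫ s, Real.exp (-l * s) ∂P = Real.exp (-r * φ l))
    {l d : ℝ} (hl : 0 < l) (hφ : HasDerivAt φ d l) :
    ∫⁻ s, ENNReal.ofReal (Real.exp (-l * s)) * ENNReal.ofReal s ∂P =
      ENNReal.ofReal (r * d * Real.exp (-r * φ l)) := by
  have hsub : Iio 0 ⊆ ProbabilityTheory.integrableExpSet id P := fun t (ht : t < 0) => by
    by_contra hcon
    have := hlap (-t) (by linarith)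
    rw [neg_neg, integral_undef (f := fun s => Real.exp (t * s)) hcon] at this
    exact (Real.exp_pos _).ne this
  have hmem : -l ∈ interior (ProbabilityTheory.integrableExpSet id P) :=
    interior_maximal hsub isOpen_Iio (show -l < 0 by linarith)
  have h1 := ProbabilityTheory.hasDerivAt_mgf hmem
  have h2 : HasDerivAt (fun m => Real.exp (-r * φ (-m)))
      (Real.exp (-r * φ (-(-l))) * (-r * (d * -1))) (-l) :=
    ((HasDerivAt.comp (-l) (by simpa using hφ) (hasDerivAt_neg (-l))).const_mul (-r)).exp
  have h3 : (ProbabilityTheory.mgf id P) =ᶠ[𝓝 (-l)] fun m => Real.exp (-r * φ (-m)) := by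
    filter_upwards [Iio_mem_nhds (show -l < 0 by linarith)] with m (hm : m < 0)
    simpa [ProbabilityTheory.mgf] using hlap (-m) (by linarith)
  have h4 := h1.unique (h2.congr_of_eventuallyEq h3)
  have hint : Integrable (fun s => s * Real.exp (-l * s)) P := by
    simpa using ProbabilityTheory.integrable_pow_mul_exp_of_mem_interior_integrableExpSet hmem 1
  have h5 : r * d * Real.exp (-r * φ l) = ∫ s, s * Real.exp (-l * s) ∂P := by
    rw [neg_neg] at h4
    simp only [id] at h4
    rw [h4]; ring
  rw [h5, ofReal_integral_eq_lintegral_ofReal hint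
    (by filter_upwards [hP] with s hs using by positivity)]
  refine lintegral_congr fun s => ?_
  rw [← ENNReal.ofReal_mul (Real.exp_nonneg _), mul_comm]

theorem eq_withDensity_indicator {M : Measure ℝ} {S : Set ℝ} (hS : MeasurableSet S)
    {f : ℝ → ℝ≥0∞} (h : ∀ A : Set ℝ, MeasurableSet A → M A = ∫⁻ x in A ∩ S, f x) :
    M = volume.withDensity (S.indicator f) := by
  ext A hA
  rw [h A hA, withDensity_apply _ hA, setLIntegral_indicator hS, inter_comm]

/-- The size-biased marginal of a subordinator with Lévy density `v` is, up to the factor `r`,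
the convolution of `x v(x) dx` with the marginal itself. -/
theorem ofReal_mul_density_ae_eq_lconvolution {ν : Measure ℝ}
    (hν : ∫⁻ x in Ioi (0 : ℝ), ENNReal.ofReal (min 1 x) ∂ν ≠ ⊤) {φ : ℝ → ℝ}
    (hφ : ∀ l : ℝ, 0 < l → φ l = ∫ x in Ioi (0 : ℝ), (1 - Real.exp (-l * x)) ∂ν)
    {v : ℝ → ℝ} (hv : Measurable v)
    (hνv : ∀ A : Set ℝ, MeasurableSet A → ν A = ∫⁻ x in A ∩ Ioi 0, ENNReal.ofReal (v x))
    {P : Measure ℝ} [IsProbabilityMeasure P] {r : ℝ} (hr : 0 < r)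
    (hlap : ∀ l : ℝ, 0 < l → ∫ s, Real.exp (-l * s) ∂P = Real.exp (-r * φ l))
    {q : ℝ → ℝ} (hq : Measurable q)
    (hPq : ∀ A : Set ℝ, MeasurableSet A → P A = ∫⁻ t in A ∩ Ici 0, ENNReal.ofReal (q t)) :
    (fun s => ENNReal.ofReal s * (Ici 0).indicator (fun s => ENNReal.ofReal (q s)) s) =ᵐ[volume]
      fun s => ENNReal.ofReal r * ∫⁻ y, (Ioi 0).indicator (fun x => ENNReal.ofReal (x * v x)) y *
        (Ici 0).indicator (fun s => ENNReal.ofReal (q s)) (-y + s) := by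
  set k : ℝ → ℝ≥0∞ := (Ioi 0).indicator fun x => ENNReal.ofReal (x * v x) with hk
  set p : ℝ → ℝ≥0∞ := (Ici 0).indicator fun s => ENNReal.ofReal (q s) with hp
  have hkm : Measurable k := Measurable.indicator (by fun_prop) measurableSet_Ioi
  have hpm : Measurable p := Measurable.indicator (by fun_prop) measurableSet_Ici
  have hP : P = volume.withDensity p := eq_withDensity_indicator measurableSet_Ici hPq
  have hν' : ν = volume.withDensity ((Ioi 0).indicator fun x => ENNReal.ofReal (v x)) :=
    eq_withDensity_indicator measurableSet_Ioi hνv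
  have hvm : Measurable ((Ioi 0).indicator fun x => ENNReal.ofReal (v x)) :=
    Measurable.indicator (by fun_prop) measurableSet_Ioi
  have hP0 : ∀ᵐ s ∂P, 0 ≤ s := by
    have : P (Iio 0) = 0 := by
      rw [hPq _ measurableSet_Iio, Iio_inter_Ici, Ico_self]; simp
    rw [ae_iff]; simpa [Iio] using this
  have hsize : ∀ l : ℝ, 0 < l →
      ∫⁻ s, ENNReal.ofReal (Real.exp (-l * s)) * (ENNReal.ofReal s * p s) =
        ENNReal.ofReal (r * (∫ x in Ioi (0 : ℝ), x * Real.exp (-l * x) ∂ν) *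
          Real.exp (-r * φ l)) := by
    intro l hl
    have hder : HasDerivAt φ (∫ x in Ioi (0 : ℝ), x * Real.exp (-l * x) ∂ν) l := by
      refine (hasDerivAt_laplaceExponent hν hl).2.congr_of_eventuallyEq ?_
      filter_upwards [Ioi_mem_nhds hl] with m hm using hφ m hm
    rw [← lintegral_exp_mul_ofReal_of_laplace hP0 hlap hl hder, hP,
      lintegral_withDensity_eq_lintegral_mul _ hpm (by fun_prop)]
    refine lintegral_congr fun s => ?_
    simp only [Pi.mul_apply]
    ring
  refine ae_eq_of_laplace_eq (by fun_prop) ?_ ?_ ?_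
  · exact (measurable_lconvolution volume hkm hpm).const_mul _
  · intro l hl
    rw [hsize l hl]
    exact ENNReal.ofReal_ne_top
  · intro l hl
    have h1 : ∫⁻ x, ENNReal.ofReal (Real.exp (-l * x)) * p x =
        ENNReal.ofReal (Real.exp (-r * φ l)) := by
      have hint : Integrable (fun s => Real.exp (-l * s)) P := by
        by_contra hcon
        have := hlap l hl
        rw [integral_undef hcon] at this
        exact (Real.exp_pos _).ne this
      rw [← hlap l hl, ofReal_integral_eq_lintegral_ofReal hint
        (ae_of_all _ fun _ => Real.exp_nonneg _), hP,
        lintegral_withDensity_eq_lintegral_mul _ hpm (by fun_prop)]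
      exact lintegral_congr fun s => mul_comm _ _
    have h2 : ∫⁻ x, ENNReal.ofReal (Real.exp (-l * x)) * k x =
        ENNReal.ofReal (∫ x in Ioi (0 : ℝ), x * Real.exp (-l * x) ∂ν) := by
      rw [ofReal_integral_eq_lintegral_ofReal (hasDerivAt_laplaceExponent hν hl).1]
      · rw [hν', ← lintegral_indicator measurableSet_Ioi,
          lintegral_withDensity_eq_lintegral_mul _ hvm
            (Measurable.indicator (by fun_prop) measurableSet_Ioi)]
        refine lintegral_congr fun x => ?_
        by_cases hx : x ∈ Ioi (0 : ℝ)
        · have hx' : (0 : ℝ) ≤ x := le_of_lt hx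
          simp only [hk, Pi.mul_apply, indicator_of_mem hx]
          rw [ENNReal.ofReal_mul hx', ENNReal.ofReal_mul hx']
          ring
        · simp [hk, hx]
      · filter_upwards [ae_restrict_mem measurableSet_Ioi] with x (hx : 0 < x)
        positivity
    have h3 : ∀ a b : ℝ≥0∞, a * (ENNReal.ofReal r * b) = ENNReal.ofReal r * (a * b) :=
      fun a b => mul_left_comm _ _ _
    rw [hsize l hl]
    simp_rw [h3]
    rw [lintegral_const_mul' _ _ ENNReal.ofReal_ne_top, lintegral_exp_mul_lconvolution hkm hpm,
      h1, h2, mul_assoc, ENNReal.ofReal_mul hr.le, ENNReal.ofReal_mul]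
    refine setIntegral_nonneg measurableSet_Ioi fun x (hx : 0 < x) => ?_
    positivity

theorem half_le_one_sub_exp_neg {u : ℝ} (h0 : 0 ≤ u) (h1 : u ≤ 1) :
    u / 2 ≤ 1 - Real.exp (-u) := by
  have h := Real.add_one_le_exp u
  have h2 : Real.exp (-u) * Real.exp u = 1 := by rw [← Real.exp_add]; simp
  nlinarith [Real.exp_pos (-u)]

section LevyDensity

variable {φ v : ℝ → ℝ}

theorem laplaceExponent_eq_lintegral {ν : Measure ℝ}
    (hν : ∫⁻ x in Ioi (0 : ℝ), ENNReal.ofReal (min 1 x) ∂ν ≠ ⊤)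
    (hφ : ∀ l : ℝ, 0 < l → φ l = ∫ x in Ioi (0 : ℝ), (1 - Real.exp (-l * x)) ∂ν)
    (hv : Measurable v)
    (hνv : ∀ A : Set ℝ, MeasurableSet A → ν A = ∫⁻ x in A ∩ Ioi 0, ENNReal.ofReal (v x))
    {l : ℝ} (hl : 0 < l) :
    0 ≤ φ l ∧ ENNReal.ofReal (φ l) =
      ∫⁻ x in Ioi 0, ENNReal.ofReal (1 - Real.exp (-l * x)) * ENNReal.ofReal (v x) := by
  have hν' : ν = volume.withDensity ((Ioi 0).indicator fun x => ENNReal.ofReal (v x)) :=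
    eq_withDensity_indicator measurableSet_Ioi hνv
  have hvm : Measurable ((Ioi 0).indicator fun x => ENNReal.ofReal (v x)) :=
    Measurable.indicator (by fun_prop) measurableSet_Ioi
  have hpos : ∀ x ∈ Ioi (0 : ℝ), 0 ≤ 1 - Real.exp (-l * x) := fun x (hx : 0 < x) =>
    sub_nonneg.2 (Real.exp_le_one_iff.2 (by nlinarith))
  refine ⟨hφ l hl ▸ setIntegral_nonneg measurableSet_Ioi hpos, ?_⟩
  rw [hφ l hl, ofReal_integral_eq_lintegral_ofReal (integrableOn_one_sub_exp hν hl)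
    (by filter_upwards [ae_restrict_mem measurableSet_Ioi] with x hx using hpos x hx),
    ← lintegral_indicator measurableSet_Ioi, ← lintegral_indicator measurableSet_Ioi, hν',
    lintegral_withDensity_eq_lintegral_mul _ hvm
      (Measurable.indicator (by fun_prop) measurableSet_Ioi)]
  refine lintegral_congr fun x => ?_
  by_cases hx : x ∈ Ioi (0 : ℝ)
  · simp only [Pi.mul_apply, indicator_of_mem hx]
    ring
  · simp [hx]

/-- The truncated first moment of a Lévy measure is controlled by its Laplace exponent. -/
theorem lintegral_mul_levyDensity_le
    (hφ : ∀ l : ℝ, 0 < l → 0 ≤ φ l ∧ ENNReal.ofReal (φ l) =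
      ∫⁻ x in Ioi 0, ENNReal.ofReal (1 - Real.exp (-l * x)) * ENNReal.ofReal (v x))
    {h : ℝ} (hh : 0 < h) :
    ∫⁻ x in Ioc 0 h, ENNReal.ofReal (x * v x) ≤ ENNReal.ofReal (2 * h * φ h⁻¹) := by
  rw [ENNReal.ofReal_mul (by positivity), (hφ _ (inv_pos.2 hh)).2,
    ← lintegral_const_mul' _ _ ENNReal.ofReal_ne_top]
  refine (setLIntegral_mono' measurableSet_Ioc fun x hx => ?_).trans
    (lintegral_mono_set Ioc_subset_Ioi_self)
  rw [← mul_assoc, ENNReal.ofReal_mul hx.1.le,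
    ← ENNReal.ofReal_mul (by positivity : 0 ≤ 2 * h)]
  gcongr
  have := half_le_one_sub_exp_neg (u := h⁻¹ * x) (by have := hx.1; positivity)
    (by rw [inv_mul_le_iff₀ hh]; linarith [hx.2])
  rw [neg_mul]
  calc x = 2 * h * (h⁻¹ * x / 2) := by field_simp
    _ ≤ _ := by gcongr

theorem mul_levyDensity_le
    (hφ : ∀ l : ℝ, 0 < l → 0 ≤ φ l ∧ ENNReal.ofReal (φ l) =
      ∫⁻ x in Ioi 0, ENNReal.ofReal (1 - Real.exp (-l * x)) * ENNReal.ofReal (v x))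
    (hanti : AntitoneOn (fun t => t * v t) (Ioi 0)) (hv0 : ∀ x, 0 ≤ v x)
    {h : ℝ} (hh : 0 < h) : h * v h ≤ 4 * φ h⁻¹ := by
  obtain ⟨h0, h1⟩ := hφ _ (inv_pos.2 hh)
  rw [← ENNReal.ofReal_le_ofReal_iff (by positivity), ENNReal.ofReal_mul zero_le_four, h1,
    ← lintegral_const_mul' _ _ ENNReal.ofReal_ne_top]
  calc ENNReal.ofReal (h * v h) = ∫⁻ x in Ioc (h / 2) h, ENNReal.ofReal (2 * v h) := by
        rw [setLIntegral_const, Real.volume_Ioc, ← ENNReal.ofReal_mul (by have := hv0 h; positivity)]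
        ring_nf
    _ ≤ ∫⁻ x in Ioc (h / 2) h, ENNReal.ofReal 4 *
          (ENNReal.ofReal (1 - Real.exp (-h⁻¹ * x)) * ENNReal.ofReal (v x)) := by
        refine setLIntegral_mono' measurableSet_Ioc fun x hx => ?_
        have hx0 : 0 < x := by linarith [hx.1]
        have hb := half_le_one_sub_exp_neg (u := h⁻¹ * x) (by positivity)
          (by rw [inv_mul_le_iff₀ hh]; linarith [hx.2])
        have hb0 : 0 ≤ h⁻¹ * x / 2 := by positivity
        rw [neg_mul, ← ENNReal.ofReal_mul (hb0.trans hb), ← ENNReal.ofReal_mul zero_le_four]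
        refine ENNReal.ofReal_le_ofReal ?_
        have hK : h * v h ≤ x * v x := hanti hx0 hh hx.2
        calc 2 * v h = 2 * h⁻¹ * (h * v h) := by field_simp
          _ ≤ 2 * h⁻¹ * (x * v x) := by gcongr
          _ = 4 * (h⁻¹ * x / 2 * v x) := by ring
          _ ≤ _ := by gcongr; exact hv0 x
    _ ≤ _ := lintegral_mono_set fun x hx => lt_trans (by positivity : (0 : ℝ) < h / 2) hx.1

theorem laplaceExponent_le_add
    (hφ : ∀ l : ℝ, 0 < l → 0 ≤ φ l ∧ ENNReal.ofReal (φ l) =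
      ∫⁻ x in Ioi 0, ENNReal.ofReal (1 - Real.exp (-l * x)) * ENNReal.ofReal (v x))
    (hanti : AntitoneOn (fun t => t * v t) (Ioi 0)) (hv0 : ∀ x, 0 ≤ v x) (hv : Measurable v)
    {a b t : ℝ} (ha : 0 < a) (hb : 0 < b) (ht : 0 < t) :
    φ t⁻¹ ≤ 2 * a * φ (a * t)⁻¹ + 2 * φ (b * t)⁻¹ + b / a * (a * t * v (a * t)) := by
  have hat : 0 < a * t := by positivity
  have hbt : 0 < b * t := by positivity
  obtain ⟨h0, h1⟩ := hφ _ (inv_pos.2 ht)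
  obtain ⟨h0a, h1a⟩ := hφ _ (inv_pos.2 hat)
  obtain ⟨h0b, h1b⟩ := hφ _ (inv_pos.2 hbt)
  have hva := hv0 (a * t)
  have hpt : ∀ x ∈ Ioi (0 : ℝ), ENNReal.ofReal (1 - Real.exp (-t⁻¹ * x)) * ENNReal.ofReal (v x) ≤
      ENNReal.ofReal (2 * a) * (ENNReal.ofReal (1 - Real.exp (-(a * t)⁻¹ * x)) *
        ENNReal.ofReal (v x)) +
      ENNReal.ofReal 2 * (ENNReal.ofReal (1 - Real.exp (-(b * t)⁻¹ * x)) *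
        ENNReal.ofReal (v x)) +
      (Icc 0 (b * t)).indicator (fun _ => ENNReal.ofReal (v (a * t))) x := by
    intro x (hx : 0 < x)
    simp only [neg_mul]
    rcases le_total x (a * t) with hxa | hxa
    · refine le_add_right (le_add_right ?_)
      rw [← mul_assoc, ← ENNReal.ofReal_mul (by positivity : 0 ≤ 2 * a)]
      gcongr
      have := half_le_one_sub_exp_neg (u := (a * t)⁻¹ * x) (by positivity)
        (by rw [inv_mul_le_iff₀ hat]; linarith)
      calc 1 - Real.exp (-(t⁻¹ * x)) ≤ t⁻¹ * x := by
            linarith [Real.add_one_le_exp (-(t⁻¹ * x))]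
        _ = 2 * a * ((a * t)⁻¹ * x / 2) := by field_simp
        _ ≤ _ := by gcongr
    rcases le_total x (b * t) with hxb | hxb
    · refine le_add_left ?_
      rw [indicator_of_mem (show x ∈ Icc 0 (b * t) from ⟨hx.le, hxb⟩)]
      refine (mul_le_of_le_one_left zero_le ?_).trans (ENNReal.ofReal_le_ofReal ?_)
      · rw [ENNReal.ofReal_le_one]; linarith [Real.exp_pos (-(t⁻¹ * x))]
      · have hK : x * v x ≤ a * t * v (a * t) := hanti hat hx hxa
        by_contra! hcon
        nlinarith
    · refine le_add_right (le_add_left ?_)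
      rw [← mul_assoc, ← ENNReal.ofReal_mul zero_le_two]
      gcongr
      have h2 := half_le_one_sub_exp_neg (u := 1) zero_le_one le_rfl
      have h3 : Real.exp (-((b * t)⁻¹ * x)) ≤ Real.exp (-1) := by
        refine Real.exp_le_exp.2 (neg_le_neg ?_)
        rw [le_inv_mul_iff₀ hbt]; linarith
      linarith [Real.exp_pos (-(t⁻¹ * x))]
  rw [← ENNReal.ofReal_le_ofReal_iff (by positivity), ENNReal.ofReal_add (by positivity)
    (by positivity), ENNReal.ofReal_add (by positivity) (by positivity),
    ENNReal.ofReal_mul (p := 2 * a) (by positivity), ENNReal.ofReal_mul (q := φ (b * t)⁻¹) zero_le_two, h1, h1a, h1b,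
    ← lintegral_const_mul' _ _ ENNReal.ofReal_ne_top,
    ← lintegral_const_mul' _ _ ENNReal.ofReal_ne_top]
  refine (setLIntegral_mono' measurableSet_Ioi hpt).trans ?_
  rw [lintegral_add_right _ (Measurable.indicator (by fun_prop) measurableSet_Icc),
    lintegral_add_right _ (by fun_prop)]
  gcongr
  refine (setLIntegral_le_lintegral _ _).trans ?_
  rw [lintegral_indicator_const measurableSet_Icc, Real.volume_Icc,
    ← ENNReal.ofReal_mul hva]
  refine ENNReal.ofReal_le_ofReal (le_of_eq ?_)
  field_simp
  ring

end LevyDensity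

section WeakScaling

variable {φ v : ℝ → ℝ} {β₁ β₂ c₁ c₂ : ℝ}

theorem laplaceExponent_inv_le (hpos : ∀ l, 0 < l → 0 < φ l)
    (hup : ∀ l : ℝ, 0 < l → ∀ κ : ℝ, 1 ≤ κ → φ (κ * l) / φ l ≤ c₂ * κ ^ β₂)
    {h t : ℝ} (hh : 0 < h) (hht : h ≤ t) : φ h⁻¹ ≤ c₂ * (t / h) ^ β₂ * φ t⁻¹ := by
  have ht : 0 < t := hh.trans_le hht
  have := hup t⁻¹ (inv_pos.2 ht) (t / h) ((one_le_div hh).2 hht)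
  rw [div_le_iff₀ (hpos _ (inv_pos.2 ht))] at this
  rwa [show t / h * t⁻¹ = h⁻¹ by field_simp] at this

theorem exists_pos_lt_one_mul_rpow_le (C : ℝ) {γ δ : ℝ} (hγ : 0 < γ) (hδ : 0 < δ) :
    ∃ ε : ℝ, 0 < ε ∧ ε ≤ 1 / 2 ∧ C * ε ^ γ ≤ δ := by
  have h1 : Tendsto (fun ε : ℝ => C * ε ^ γ) (𝓝[>] 0) (𝓝 (C * 0 ^ γ)) :=
    ((Real.continuousAt_rpow_const 0 γ (Or.inr hγ.le)).const_mul C).tendsto.mono_left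
      nhdsWithin_le_nhds
  rw [Real.zero_rpow hγ.ne', mul_zero] at h1
  have h2 : ∀ᶠ ε : ℝ in 𝓝[>] 0, ε ≤ 1 / 2 :=
    mem_nhdsWithin_of_mem_nhds (Iic_mem_nhds (by norm_num))
  obtain ⟨ε, hε, hε2, hε3⟩ :=
    ((eventually_mem_nhdsWithin (a := (0 : ℝ)) (s := Ioi 0)).and
      (h2.and (h1.eventually (Iic_mem_nhds hδ)))).exists
  exact ⟨ε, hε, hε2, hε3⟩

/-- Under weak scaling, `x ↦ x v(x)` is bounded below by a multiple of `φ(1/x)`. -/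
theorem exists_mul_laplaceExponent_le_mul_levyDensity
    (hφ : ∀ l : ℝ, 0 < l → 0 ≤ φ l ∧ ENNReal.ofReal (φ l) =
      ∫⁻ x in Ioi 0, ENNReal.ofReal (1 - Real.exp (-l * x)) * ENNReal.ofReal (v x))
    (hanti : AntitoneOn (fun t => t * v t) (Ioi 0)) (hv0 : ∀ x, 0 ≤ v x) (hv : Measurable v)
    (hpos : ∀ l, 0 < l → 0 < φ l) (hβ₁ : 0 < β₁) (hβ₂ : β₂ < 1) (hc₁ : 0 < c₁) (hc₂ : 0 < c₂)
    (hlow : ∀ l : ℝ, 0 < l → ∀ κ : ℝ, 1 ≤ κ → c₁ * κ ^ β₁ ≤ φ (κ * l) / φ l)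
    (hup : ∀ l : ℝ, 0 < l → ∀ κ : ℝ, 1 ≤ κ → φ (κ * l) / φ l ≤ c₂ * κ ^ β₂) :
    ∃ c : ℝ, 0 < c ∧ ∀ t : ℝ, 0 < t → c * φ t⁻¹ ≤ t * v t := by
  obtain ⟨a, ha, ha1, ha2⟩ := exists_pos_lt_one_mul_rpow_le (2 * c₂) (sub_pos.2 hβ₂)
    (by norm_num : (0 : ℝ) < 1 / 4)
  obtain ⟨e, he, he1, he2⟩ := exists_pos_lt_one_mul_rpow_le (2 / c₁) hβ₁
    (by norm_num : (0 : ℝ) < 1 / 4)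
  have key : ∀ t : ℝ, 0 < t → a * e / 2 * φ t⁻¹ ≤ a * t * v (a * t) := by
    intro t ht
    have hsum := laplaceExponent_le_add hφ hanti hv0 hv ha (inv_pos.2 he) ht
    have hΦ := hpos _ (inv_pos.2 ht)
    have h1 : 2 * a * φ (a * t)⁻¹ ≤ 1 / 4 * φ t⁻¹ := by
      have := laplaceExponent_inv_le hpos hup (mul_pos ha ht) (by nlinarith : a * t ≤ t)
      have h3 : t / (a * t) = a⁻¹ := by field_simp
      rw [h3] at this
      have h4 : a * a⁻¹ ^ β₂ = a ^ (1 - β₂) := by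
        rw [Real.rpow_sub ha, Real.rpow_one, Real.inv_rpow ha.le]; rfl
      calc 2 * a * φ (a * t)⁻¹ ≤ 2 * a * (c₂ * a⁻¹ ^ β₂ * φ t⁻¹) := by gcongr
        _ = 2 * c₂ * (a * a⁻¹ ^ β₂) * φ t⁻¹ := by ring
        _ ≤ _ := by rw [h4]; gcongr
    have h2 : 2 * φ (e⁻¹ * t)⁻¹ ≤ 1 / 4 * φ t⁻¹ := by
      have hψ := hpos (e⁻¹ * t)⁻¹ (by positivity)
      have := hlow (e⁻¹ * t)⁻¹ (by positivity) e⁻¹ ((one_le_inv₀ he).2 (by linarith))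
      have h3 : e⁻¹ * (e⁻¹ * t)⁻¹ = t⁻¹ := by field_simp
      rw [h3, le_div_iff₀ hψ, Real.inv_rpow he.le] at this
      have h5 : 0 < e ^ β₁ := Real.rpow_pos_of_pos he _
      calc 2 * φ (e⁻¹ * t)⁻¹ = 2 / c₁ * e ^ β₁ * (c₁ * (e ^ β₁)⁻¹ * φ (e⁻¹ * t)⁻¹) := by
            field_simp
        _ ≤ 2 / c₁ * e ^ β₁ * φ t⁻¹ := by gcongr
        _ ≤ _ := by gcongr
    have h3 : 1 / 2 * φ t⁻¹ ≤ e⁻¹ / a * (a * t * v (a * t)) := by linarith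
    calc a * e / 2 * φ t⁻¹ = a * e * (1 / 2 * φ t⁻¹) := by ring
      _ ≤ a * e * (e⁻¹ / a * (a * t * v (a * t))) := by gcongr
      _ = _ := by field_simp
  refine ⟨a * e / 2 * (c₂ * a⁻¹ ^ β₂)⁻¹, by positivity, fun t ht => ?_⟩
  have h1 := key (t / a) (by positivity)
  have h2 := laplaceExponent_inv_le hpos hup ht (by rw [le_div_iff₀ ha]; nlinarith : t ≤ t / a)
  rw [mul_div_cancel₀ _ ha.ne'] at h1
  rw [show t / a / t = a⁻¹ by field_simp] at h2
  have h3 : 0 < c₂ * a⁻¹ ^ β₂ := by positivity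
  refine le_trans ?_ h1
  rw [mul_assoc]
  gcongr
  rwa [inv_mul_le_iff₀ h3]

/-- A subordinator marginal charges `[0, t/2]` uniformly as long as `r φ(1/t)` is bounded. -/
theorem exists_le_measureReal_Icc (hpos : ∀ l, 0 < l → 0 < φ l) (hβ₂ : β₂ < 1)
    (hup : ∀ l : ℝ, 0 < l → ∀ κ : ℝ, 1 ≤ κ → φ (κ * l) / φ l ≤ c₂ * κ ^ β₂)
    (hc₂ : 0 < c₂) {L : ℝ} :
    ∃ η : ℝ, 0 < η ∧ ∀ (P : Measure ℝ) [IsProbabilityMeasure P] (r t : ℝ), 0 < r → 0 < t →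
      (∀ᵐ s ∂P, 0 ≤ s) →
      (∀ l : ℝ, 0 < l → ∫ s, Real.exp (-l * s) ∂P = Real.exp (-r * φ l)) →
      r * φ t⁻¹ ≤ L → η ≤ P.real (Icc 0 (t / 2)) := by
  obtain ⟨ε, hε, hε1, hε2⟩ := exists_pos_lt_one_mul_rpow_le (c₂ * L) (sub_pos.2 hβ₂)
    (by norm_num : (0 : ℝ) < 1 / 4)
  obtain ⟨δ, hδ, hδε, hδ4⟩ : ∃ δ : ℝ, 0 < δ ∧ δ ≤ ε ∧ δ ≤ 1 / 4 :=
    ⟨min ε (1 / 4), by positivity, min_le_left _ _, min_le_right _ _⟩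
  refine ⟨Real.exp (-(δ⁻¹ / 2)), Real.exp_pos _, fun P _ r t hr ht hP hlap hL => ?_⟩
  have hL0 : 0 < L := (mul_pos hr (hpos _ (inv_pos.2 ht))).trans_le hL
  have hδ2 : c₂ * L * δ ^ (1 - β₂) ≤ 1 / 4 := by
    refine le_trans ?_ hε2
    have := Real.rpow_le_rpow hδ.le hδε (sub_pos.2 hβ₂).le
    gcongr
  have hint : Integrable (fun s => Real.exp (-(δ * t)⁻¹ * s)) P := by
    by_contra hcon
    have := hlap (δ * t)⁻¹ (by positivity)
    rw [integral_undef hcon] at this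
    exact (Real.exp_pos _).ne this
  have hupper : Real.exp (-r * φ (δ * t)⁻¹) ≤
      P.real (Icc 0 (t / 2)) + Real.exp (-(δ⁻¹ / 2)) := by
    rw [← hlap _ (by positivity)]
    calc ∫ s, Real.exp (-(δ * t)⁻¹ * s) ∂P
        ≤ ∫ s, ((Icc 0 (t / 2)).indicator (fun _ => (1 : ℝ)) s + Real.exp (-(δ⁻¹ / 2))) ∂P := by
          refine integral_mono_ae hint
            (((integrable_const 1).indicator measurableSet_Icc).add (integrable_const _)) ?_
          filter_upwards [hP] with s hs
          rcases le_or_gt s (t / 2) with h | h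
          · rw [indicator_of_mem (show s ∈ Icc 0 (t / 2) from ⟨hs, h⟩)]
            have : Real.exp (-(δ * t)⁻¹ * s) ≤ 1 := by
              rw [Real.exp_le_one_iff, neg_mul, neg_nonpos]; positivity
            linarith [Real.exp_pos (-(δ⁻¹ / 2))]
          · rw [indicator_of_notMem (fun hs => by linarith [hs.2]), zero_add,
              Real.exp_le_exp, neg_mul, neg_le_neg_iff]
            calc δ⁻¹ / 2 = (δ * t)⁻¹ * (t / 2) := by field_simp
              _ ≤ _ := by gcongr
      _ = _ := by
          rw [integral_add ((integrable_const 1).indicator measurableSet_Icc)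
            (integrable_const _), integral_indicator_const _ measurableSet_Icc]
          simp
  have hlower : 2 * Real.exp (-(δ⁻¹ / 2)) ≤ Real.exp (-r * φ (δ * t)⁻¹) := by
    have h1 := laplaceExponent_inv_le hpos hup (mul_pos hδ ht) (by nlinarith : δ * t ≤ t)
    rw [show t / (δ * t) = δ⁻¹ by field_simp] at h1
    have h4 : δ⁻¹ ^ β₂ = δ ^ (1 - β₂) * δ⁻¹ := by
      rw [Real.rpow_sub hδ, Real.rpow_one, Real.inv_rpow hδ.le]; field_simp
    have h5 : r * φ (δ * t)⁻¹ ≤ δ⁻¹ / 4 := by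
      calc r * φ (δ * t)⁻¹ ≤ r * (c₂ * δ⁻¹ ^ β₂ * φ t⁻¹) := by gcongr
        _ = c₂ * δ⁻¹ ^ β₂ * (r * φ t⁻¹) := by ring
        _ ≤ c₂ * δ⁻¹ ^ β₂ * L := by gcongr
        _ = c₂ * L * δ ^ (1 - β₂) * δ⁻¹ := by rw [h4]; ring
        _ ≤ 1 / 4 * δ⁻¹ := by gcongr
        _ = _ := by ring
    have h6 : 4 ≤ δ⁻¹ := by
      rw [le_inv_comm₀ (by norm_num) hδ]; linarith
    have h7 : (2 : ℝ) ≤ Real.exp 1 := by linarith [Real.add_one_le_exp (1 : ℝ)]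
    calc 2 * Real.exp (-(δ⁻¹ / 2)) ≤ Real.exp 1 * Real.exp (-(δ⁻¹ / 2)) := by gcongr
      _ = Real.exp (1 + -(δ⁻¹ / 2)) := (Real.exp_add _ _).symm
      _ ≤ _ := Real.exp_le_exp.2 (by linarith)
  linarith

end WeakScaling

theorem le_on_Icc_of_ae_le_on_Ioo {f g : ℝ → ℝ} (hf : Continuous f) (hg : Continuous g)
    {a b : ℝ} (hab : a < b) (h : ∀ᵐ s, s ∈ Ioo a b → f s ≤ g s) :
    ∀ s ∈ Icc a b, f s ≤ g s := by
  have hclosed : IsClosed {s | f s ≤ g s} := isClosed_le hf hg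
  have hsub : Ioo a b ⊆ {s | f s ≤ g s} := by
    have hopen : IsOpen (Ioo a b ∩ {s | f s ≤ g s}ᶜ) := isOpen_Ioo.inter hclosed.isOpen_compl
    have hnull : volume (Ioo a b ∩ {s | f s ≤ g s}ᶜ) = 0 := by
      rw [ae_iff] at h
      refine measure_mono_null (fun s hs => ?_) h
      simpa [and_assoc] using hs
    have := hopen.measure_eq_zero_iff volume |>.1 hnull
    rwa [← sdiff_eq, sdiff_eq_empty] at this
  rw [← closure_Ioo hab.ne]
  exact hclosed.closure_subset_iff.2 hsub

section DensityBounds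

variable {v q : ℝ → ℝ} {r : ℝ}

/-- Lower bound for a density `q` satisfying the size-bias convolution equation. -/
theorem mul_levyDensity_mul_measureReal_le (hr : 0 < r)
    (hanti : AntitoneOn (fun t => t * v t) (Ioi 0)) (hv0 : ∀ x, 0 ≤ v x)
    (hq : Continuous q) (hq0 : ∀ s, 0 ≤ q s)
    (heq : (fun s => ENNReal.ofReal s * (Ici 0).indicator (fun s => ENNReal.ofReal (q s)) s)
      =ᵐ[volume] fun s => ENNReal.ofReal r *
        ∫⁻ y, (Ioi 0).indicator (fun x => ENNReal.ofReal (x * v x)) y *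
          (Ici 0).indicator (fun s => ENNReal.ofReal (q s)) (-y + s))
    {P : Measure ℝ} [IsProbabilityMeasure P]
    (hPq : ∀ A : Set ℝ, MeasurableSet A → P A = ∫⁻ t in A ∩ Ici 0, ENNReal.ofReal (q t))
    {t : ℝ} (ht : 0 < t) : r * (t * v t) * P.real (Icc 0 (t / 2)) ≤ t * q t := by
  refine le_on_Icc_of_ae_le_on_Ioo (f := fun _ => r * (t * v t) * P.real (Icc 0 (t / 2)))
    (g := fun s => s * q s) continuous_const (by fun_prop) (half_lt_self ht) ?_ t
    ⟨by linarith, le_rfl⟩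
  filter_upwards [heq] with s hs hst
  have hs0 : 0 < s := by linarith [hst.1]
  have hvt := hv0 t
  rw [indicator_of_mem (show s ∈ Ici 0 from hs0.le), ← ENNReal.ofReal_mul hs0.le] at hs
  rw [← ENNReal.ofReal_le_ofReal_iff (mul_nonneg hs0.le (hq0 s)), hs, mul_assoc,
    ENNReal.ofReal_mul hr.le, ENNReal.ofReal_mul (by positivity), ofReal_measureReal,
    hPq _ measurableSet_Icc, inter_eq_left.2 Icc_subset_Ici_self,
    ← lintegral_indicator measurableSet_Icc, ← lintegral_const_mul' _ _ ENNReal.ofReal_ne_top,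
    ← lintegral_sub_left_eq_self _ s]
  refine mul_le_mul' le_rfl (lintegral_mono fun y => ?_)
  dsimp only
  by_cases hy : s - y ∈ Icc 0 (t / 2)
  · have hy0 : y ∈ Ioi (0 : ℝ) := show 0 < y by linarith [hy.2, hst.1]
    rw [neg_add_eq_sub, indicator_of_mem hy, indicator_of_mem hy0,
      indicator_of_mem (show s - y ∈ Ici 0 from hy.1)]
    exact mul_le_mul' (ENNReal.ofReal_le_ofReal
      (hanti hy0 ht (by linarith [hy.1, hst.2]))) le_rfl
  · rw [indicator_of_notMem hy]; simp

/-- Upper bound for a density `q` satisfying the size-bias convolution equation, in terms of a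
weighted supremum of `q`. -/
theorem mul_density_mul_le {φ : ℝ → ℝ} (hr : 0 < r)
    (hφ : ∀ l : ℝ, 0 < l → 0 ≤ φ l ∧ ENNReal.ofReal (φ l) =
      ∫⁻ x in Ioi 0, ENNReal.ofReal (1 - Real.exp (-l * x)) * ENNReal.ofReal (v x))
    (hanti : AntitoneOn (fun t => t * v t) (Ioi 0)) (hv0 : ∀ x, 0 ≤ v x)
    (hq : Continuous q) (hq0 : ∀ s, 0 ≤ q s)
    (heq : (fun s => ENNReal.ofReal s * (Ici 0).indicator (fun s => ENNReal.ofReal (q s)) s)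
      =ᵐ[volume] fun s => ENNReal.ofReal r *
        ∫⁻ y, (Ioi 0).indicator (fun x => ENNReal.ofReal (x * v x)) y *
          (Ici 0).indicator (fun s => ENNReal.ofReal (q s)) (-y + s))
    {P : Measure ℝ} [IsProbabilityMeasure P]
    (hPq : ∀ A : Set ℝ, MeasurableSet A → P A = ∫⁻ t in A ∩ Ici 0, ENNReal.ofReal (q t))
    {a b h W : ℝ} (ha : 0 ≤ a) (hh : 0 < h) (hab : a + h < b) (hW0 : 0 ≤ W)
    (hW : ∀ s ∈ Icc a b, (s - a) * q s ≤ W) :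
    ∀ s ∈ Icc (a + h) b, s * q s * (s - h - a) ≤
      r * (h * v h) * (s - h - a) + r * (2 * h * φ h⁻¹) * W := by
  refine le_on_Icc_of_ae_le_on_Ioo (by fun_prop) (by fun_prop) hab ?_
  filter_upwards [heq] with s hs hst
  have hs0 : 0 < s := by linarith [hst.1]
  have hd : 0 < s - h - a := by linarith [hst.1]
  have hvh := hv0 h
  have hφh := (hφ _ (inv_pos.2 hh)).1
  have hpm : Measurable ((Ici 0).indicator fun s => ENNReal.ofReal (q s)) :=
    Measurable.indicator (by fun_prop) measurableSet_Ici
  rw [indicator_of_mem (show s ∈ Ici 0 from hs0.le), ← ENNReal.ofReal_mul hs0.le] at hs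
  have hmass : ∫⁻ y, (Ici 0).indicator (fun s => ENNReal.ofReal (q s)) (-y + s) = 1 := by
    simp_rw [neg_add_eq_sub]
    rw [lintegral_sub_left_eq_self (fun x => (Ici 0).indicator (fun s => ENNReal.ofReal (q s)) x) s,
      lintegral_indicator measurableSet_Ici, ← measure_univ (μ := P), hPq _ MeasurableSet.univ,
      univ_inter]
  have hpt : ∀ y, (Ioi 0).indicator (fun x => ENNReal.ofReal (x * v x)) y *
      (Ici 0).indicator (fun s => ENNReal.ofReal (q s)) (-y + s) ≤
      ENNReal.ofReal (h * v h) * (Ici 0).indicator (fun s => ENNReal.ofReal (q s)) (-y + s) +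
      ENNReal.ofReal (W / (s - h - a)) *
        (Ioc 0 h).indicator (fun x => ENNReal.ofReal (x * v x)) y := by
    intro y
    rcases le_or_gt y 0 with hy0 | hy0
    · simp [hy0]
    rw [indicator_of_mem (show y ∈ Ioi 0 from hy0)]
    rcases le_or_gt y h with hyh | hyh
    · refine le_add_left ?_
      rw [indicator_of_mem (show y ∈ Ioc 0 h from ⟨hy0, hyh⟩), mul_comm]
      gcongr
      refine (indicator_le_self _ _ _).trans (ENNReal.ofReal_le_ofReal ?_)
      have hsy : 0 < -y + s - a := by linarith
      have := hW (-y + s) ⟨by linarith, by linarith [hst.2]⟩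
      rw [le_div_iff₀ hd, mul_comm]
      refine le_trans ?_ this
      have := hq0 (-y + s)
      gcongr
      linarith
    · refine le_add_right ?_
      exact mul_le_mul' (ENNReal.ofReal_le_ofReal (hanti hh hy0 hyh.le)) le_rfl
  have hbound : s * q s ≤ r * (h * v h + W / (s - h - a) * (2 * h * φ h⁻¹)) := by
    rw [← ENNReal.ofReal_le_ofReal_iff (by positivity), hs, ENNReal.ofReal_mul hr.le]
    gcongr
    calc _ ≤ _ := lintegral_mono hpt
      _ = ENNReal.ofReal (h * v h) + ENNReal.ofReal (W / (s - h - a)) *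
            ∫⁻ x in Ioc 0 h, ENNReal.ofReal (x * v x) := by
          rw [lintegral_add_left (by fun_prop), lintegral_const_mul _ (by fun_prop), hmass, mul_one,
            lintegral_const_mul' _ _ ENNReal.ofReal_ne_top, lintegral_indicator measurableSet_Ioc]
      _ ≤ ENNReal.ofReal (h * v h) + ENNReal.ofReal (W / (s - h - a)) *
            ENNReal.ofReal (2 * h * φ h⁻¹) := by
          gcongr
          exact lintegral_mul_levyDensity_le hφ hh
      _ = _ := by
          rw [← ENNReal.ofReal_mul (by positivity), ← ENNReal.ofReal_add (by positivity)
            (by positivity)]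
  calc s * q s * (s - h - a) ≤
      r * (h * v h + W / (s - h - a) * (2 * h * φ h⁻¹)) * (s - h - a) := by gcongr
    _ = _ := by field_simp

/-- Upper bound for a density `q` satisfying the size-bias convolution equation, when the Laplace
exponent `φ` grows more slowly than linearly. -/
theorem density_le {φ : ℝ → ℝ} {β₂ c₂ L ε : ℝ} (hr : 0 < r)
    (hφ : ∀ l : ℝ, 0 < l → 0 ≤ φ l ∧ ENNReal.ofReal (φ l) =
      ∫⁻ x in Ioi 0, ENNReal.ofReal (1 - Real.exp (-l * x)) * ENNReal.ofReal (v x))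
    (hanti : AntitoneOn (fun t => t * v t) (Ioi 0)) (hv0 : ∀ x, 0 ≤ v x)
    (hq : Continuous q) (hq0 : ∀ s, 0 ≤ q s)
    (heq : (fun s => ENNReal.ofReal s * (Ici 0).indicator (fun s => ENNReal.ofReal (q s)) s)
      =ᵐ[volume] fun s => ENNReal.ofReal r *
        ∫⁻ y, (Ioi 0).indicator (fun x => ENNReal.ofReal (x * v x)) y *
          (Ici 0).indicator (fun s => ENNReal.ofReal (q s)) (-y + s))
    {P : Measure ℝ} [IsProbabilityMeasure P]
    (hPq : ∀ A : Set ℝ, MeasurableSet A → P A = ∫⁻ t in A ∩ Ici 0, ENNReal.ofReal (q t))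
    (hpos : ∀ l, 0 < l → 0 < φ l) (hβ₂ : β₂ < 1) (hc₂ : 0 < c₂)
    (hup : ∀ l : ℝ, 0 < l → ∀ κ : ℝ, 1 ≤ κ → φ (κ * l) / φ l ≤ c₂ * κ ^ β₂)
    (hε : 0 < ε) (hε2 : ε ≤ 1 / 2) (hεL : 16 * c₂ * L * ε ^ (1 - β₂) ≤ 1)
    {t : ℝ} (ht : 0 < t) (hL : r * φ t⁻¹ ≤ L) :
    q t ≤ 64 * c₂ / ε / t * (r * φ t⁻¹) := by
  have hΦ := hpos _ (inv_pos.2 ht)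
  obtain ⟨s, hs, hmax⟩ := isCompact_Icc.exists_isMaxOn (s := Icc (t / 2) t)
    (nonempty_Icc.2 (by linarith)) (f := fun s => (s - t / 2) * q s) (by fun_prop)
  suffices hW : (s - t / 2) * q s ≤ 32 * c₂ / ε * (r * φ t⁻¹) by
    have h1 : (t - t / 2) * q t ≤ (s - t / 2) * q s := hmax ⟨by linarith, le_rfl⟩
    have h2 : t * q t ≤ 64 * c₂ / ε * (r * φ t⁻¹) := by
      calc t * q t = 2 * ((t - t / 2) * q t) := by ring
        _ ≤ 2 * (32 * c₂ / ε * (r * φ t⁻¹)) := by linarith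
        _ = _ := by ring
    rw [div_mul_eq_mul_div, le_div_iff₀ ht, mul_comm]
    exact h2
  have hqs := hq0 s
  rcases hs.1.eq_or_lt with hs1 | hs1
  · rw [← hs1, sub_self, zero_mul]; positivity
  set d := s - t / 2 with hd
  have hd0 : 0 < d := by linarith
  have hdt : d ≤ t := by linarith [hs.2]
  have hh : 0 < ε * d := by positivity
  have hht : ε * d ≤ t := by nlinarith
  have hmain := mul_density_mul_le hr hφ hanti hv0 hq hq0 heq hPq (a := t / 2) (b := t)
    (h := ε * d) (W := d * q s) (by positivity) hh (by nlinarith [hs.2]) (by positivity)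
    (fun x hx => hmax hx) s ⟨by nlinarith, hs.2⟩
  rw [show s - ε * d - t / 2 = (1 - ε) * d by rw [hd]; ring] at hmain
  have hφh : φ (ε * d)⁻¹ ≤ c₂ * (t / (ε * d)) ^ β₂ * φ t⁻¹ :=
    laplaceExponent_inv_le hpos hup hh hht
  have hφ0 := hpos (ε * d)⁻¹ (by positivity)
  have hK := mul_levyDensity_le hφ hanti hv0 hh
  have hK0 : 0 ≤ ε * d * v (ε * d) := mul_nonneg hh.le (hv0 _)
  have hfirst : r * (ε * d * φ (ε * d)⁻¹) ≤ t / 16 := by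
    have h1 : ε * d * (t / (ε * d)) ^ β₂ = t * (ε * d / t) ^ (1 - β₂) := by
      rw [Real.rpow_sub (by positivity), Real.rpow_one, ← inv_div t (ε * d),
        Real.inv_rpow (by positivity)]
      field_simp
    have h2 : (ε * d / t) ^ (1 - β₂) ≤ ε ^ (1 - β₂) := by
      refine Real.rpow_le_rpow (by positivity) ?_ (sub_pos.2 hβ₂).le
      rw [div_le_iff₀ ht]; gcongr
    have hL0 : 0 < L := (mul_pos hr hΦ).trans_le hL
    calc r * (ε * d * φ (ε * d)⁻¹) ≤ r * (ε * d * (c₂ * (t / (ε * d)) ^ β₂ * φ t⁻¹)) := by gcongr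
      _ = c₂ * (r * φ t⁻¹) * (ε * d * (t / (ε * d)) ^ β₂) := by ring
      _ = c₂ * (r * φ t⁻¹) * (t * (ε * d / t) ^ (1 - β₂)) := by rw [h1]
      _ ≤ c₂ * L * (t * ε ^ (1 - β₂)) := by gcongr
      _ = t / 16 * (16 * c₂ * L * ε ^ (1 - β₂)) := by ring
      _ ≤ t / 16 * 1 := by gcongr
      _ = _ := mul_one _
  have hφh' : φ (ε * d)⁻¹ ≤ c₂ * (t / (ε * d)) * φ t⁻¹ := by
    refine hφh.trans ?_
    gcongr
    exact Real.rpow_le_self_of_one_le ((one_le_div hh).2 hht) hβ₂.le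
  have hred : s * q s * (1 - ε) ≤
      r * (ε * d * v (ε * d)) * (1 - ε) + 2 * (r * (ε * d * φ (ε * d)⁻¹)) * q s := by
    refine le_of_mul_le_mul_right ?_ hd0
    linarith
  have h3 : t / 4 * q s ≤ s * q s * (1 - ε) := by
    calc t / 4 * q s = (t / 2) * q s * (1 / 2) := by ring
      _ ≤ s * q s * (1 - ε) :=
        mul_le_mul (mul_le_mul_of_nonneg_right hs.1 hqs) (by linarith) (by norm_num)
          (mul_nonneg (by linarith) hqs)
  have h4 : r * (ε * d * v (ε * d)) * (1 - ε) ≤ r * (4 * (c₂ * (t / (ε * d)) * φ t⁻¹)) := by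
    calc r * (ε * d * v (ε * d)) * (1 - ε) ≤ r * (ε * d * v (ε * d)) * 1 :=
          mul_le_mul_of_nonneg_left (by linarith) (mul_nonneg hr.le hK0)
      _ = r * (ε * d * v (ε * d)) := mul_one _
      _ ≤ _ := mul_le_mul_of_nonneg_left (hK.trans (by linarith)) hr.le
  have h5 : 2 * (r * (ε * d * φ (ε * d)⁻¹)) * q s ≤ t / 8 * q s := by
    gcongr; linarith
  have h6 : t / 8 * q s ≤ r * (4 * (c₂ * (t / (ε * d)) * φ t⁻¹)) := by linarith
  calc d * q s = 8 * d / t * (t / 8 * q s) := by field_simp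
    _ ≤ 8 * d / t * (r * (4 * (c₂ * (t / (ε * d)) * φ t⁻¹))) := by gcongr
    _ = _ := by field_simp; ring

end DensityBounds

/-- Theorem 4.4, small-value regime.  Under Assumption 4.1 (weak scaling
of the Laplace exponent `φ` with indices `0 < β₁ < β₂ < 1`, and self-decomposability:
the Lévy density `νd` has `t ↦ t·νd(t)` non-increasing), for each `L > 0` there is a
constant `c ≥ 1` such that `(1/(c t)) r φ(1/t) ≤ p̄(r,t) ≤ (c/t) r φ(1/t)` whenever
`r, t > 0` with `r φ(1/t) ≤ L`. -/
theorem time_frac_stmt10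
    (ν : Measure ℝ)
    (hν_loc : ∫⁻ x in Set.Ioi (0:ℝ), ENNReal.ofReal (min 1 x) ∂ν ≠ ⊤)
    (φ : ℝ → ℝ)
    (hφ : ∀ l : ℝ, 0 < l → φ l = ∫ x in Set.Ioi (0:ℝ), (1 - Real.exp (-l * x)) ∂ν)
    -- Assumption 4.1(i): weak scaling of φ
    (β₁ β₂ c₁ c₂ : ℝ)
    (hβ : 0 < β₁ ∧ β₁ < β₂ ∧ β₂ < 1) (hc : 0 < c₁ ∧ 0 < c₂)
    (hscale : ∀ l : ℝ, 0 < l → ∀ κ : ℝ, 1 ≤ κ →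
      c₁ * κ ^ β₁ ≤ φ (κ * l) / φ l ∧ φ (κ * l) / φ l ≤ c₂ * κ ^ β₂)
    -- Assumption 4.1(ii): ν has a density νd with t ↦ t·νd(t) non-increasing
    (νd : ℝ → ℝ)
    (hνd_nn : ∀ t : ℝ, 0 ≤ νd t)
    (hνd_meas : Measurable νd)
    (hν_dens : ∀ A : Set ℝ, MeasurableSet A →
      ν A = ∫⁻ x in A ∩ Set.Ioi 0, ENNReal.ofReal (νd x))
    (hself : AntitoneOn (fun t => t * νd t) (Set.Ioi (0:ℝ)))
    -- the subordinator marginals and their continuous densities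
    (μr : ℝ → Measure ℝ)
    (hprob : ∀ r : ℝ, 0 < r → IsProbabilityMeasure (μr r))
    (hlap : ∀ r : ℝ, 0 < r → ∀ l : ℝ, 0 < l →
      ∫ s, Real.exp (-l * s) ∂(μr r) = Real.exp (-r * φ l))
    (pbar : ℝ → ℝ → ℝ)
    (hpbar_nn : ∀ r t : ℝ, 0 ≤ pbar r t)
    (hpbar_cont : ∀ r : ℝ, 0 < r → Continuous (pbar r))
    (hdens : ∀ r : ℝ, 0 < r → ∀ A : Set ℝ, MeasurableSet A →
      μr r A = ∫⁻ t in A ∩ Set.Ici 0, ENNReal.ofReal (pbar r t)) :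
    ∀ L : ℝ, 0 < L → ∃ c : ℝ, 1 ≤ c ∧
      ∀ r t : ℝ, 0 < r → 0 < t → r * φ t⁻¹ ≤ L →
        (1 / (c * t)) * (r * φ t⁻¹) ≤ pbar r t ∧
        pbar r t ≤ (c / t) * (r * φ t⁻¹) := by
  have hpos : ∀ l, 0 < l → 0 < φ l := by
    intro l hl
    refine lt_of_le_of_ne
      (laplaceExponent_eq_lintegral hν_loc hφ hνd_meas hν_dens hl).1 fun h0 => ?_
    have := (hscale l hl 1 le_rfl).1
    rw [← h0, div_zero, Real.one_rpow, mul_one] at this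
    linarith [hc.1]
  have hφl := fun l (hl : 0 < l) =>
    laplaceExponent_eq_lintegral hν_loc hφ hνd_meas hν_dens hl
  have hup := fun l hl κ hκ => (hscale l hl κ hκ).2
  have hβ₂ : β₂ < 1 := hβ.2.2
  intro L hL
  obtain ⟨k, hk, hkb⟩ := exists_mul_laplaceExponent_le_mul_levyDensity hφl hself hνd_nn hνd_meas
    hpos hβ.1 hβ₂ hc.1 hc.2 (fun l hl κ hκ => (hscale l hl κ hκ).1) hup
  obtain ⟨η, hη, hηb⟩ := exists_le_measureReal_Icc hpos hβ₂ hup hc.2 (L := L)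
  obtain ⟨ε, hε, hε2, hεL⟩ :=
    exists_pos_lt_one_mul_rpow_le (16 * c₂ * L) (sub_pos.2 hβ₂) one_pos
  refine ⟨max 1 (max (k * η)⁻¹ (64 * c₂ / ε)), le_max_left _ _, fun r t hr ht hrt => ?_⟩
  have hΦ := hpos _ (inv_pos.2 ht)
  have := hprob r hr
  have heq := ofReal_mul_density_ae_eq_lconvolution hν_loc hφ hνd_meas hν_dens hr (hlap r hr)
    (hpbar_cont r hr).measurable (hdens r hr)
  constructor
  · have hP0 : ∀ᵐ s ∂(μr r), 0 ≤ s := by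
      have : μr r (Iio 0) = 0 := by
        rw [hdens r hr _ measurableSet_Iio, Iio_inter_Ici, Ico_self]; simp
      rw [ae_iff]; simpa [Iio] using this
    have h1 := mul_levyDensity_mul_measureReal_le hr hself hνd_nn (hpbar_cont r hr) (hpbar_nn r)
      heq (hdens r hr) ht
    have h2 := hηb (μr r) r t hr ht hP0 (hlap r hr) hrt
    have h3 := hkb t ht
    have h4 : k * η * (r * φ t⁻¹) ≤ t * pbar r t := by
      calc k * η * (r * φ t⁻¹) = r * (k * φ t⁻¹) * η := by ring
        _ ≤ r * (t * νd t) * (μr r).real (Icc 0 (t / 2)) := by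
          have := hνd_nn t
          gcongr
        _ ≤ _ := h1
    have h5 : 1 / (max 1 (max (k * η)⁻¹ (64 * c₂ / ε)) * t) ≤ 1 / ((k * η)⁻¹ * t) := by
      gcongr
      exact (le_max_left _ _).trans (le_max_right _ _)
    calc _ ≤ 1 / ((k * η)⁻¹ * t) * (r * φ t⁻¹) := by gcongr
      _ = k * η * (r * φ t⁻¹) / t := by field_simp
      _ ≤ t * pbar r t / t := by gcongr
      _ = pbar r t := by field_simp
  · refine (density_le hr hφl hself hνd_nn (hpbar_cont r hr) (hpbar_nn r) heq
      (hdens r hr) hpos hβ₂ hc.2 hup hε hε2 hεL ht hrt).trans ?_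
    gcongr
    exact (le_max_right _ _).trans (le_max_right _ _)
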